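/- Let m, k ≥ 1 and let p_1,…,p_{m+1} ∈ K[x_1,…,x_m, y_1,…,y_k] with d_{ix} := deg_x p_i ≥ 1 and d_{iy} := deg_y p_i ≥ 0 for each i. Let I := (p_1,…,p_{m+1}) be the ideal they generate, and suppose that the Krull dimension of K[x_1,…,x_m,y_1,…,y_k]/I equals k − 1 and that the elimination ideal I ∩ K[y_1,…,y_k] is the principal ideal generated by a squarefree polynomial g ∈ K[y_1,…,y_k]. Then the total degree of g satisfies deg g ≤ Σ_{i=1}^{m+1} d_{iy}·Π_{j=1, j≠i}^{m+1} d_{jx}. -/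

import Mathlib

open MvPolynomial

/-- Total degree of `p ∈ K[x_1,…,x_m,y_1,…,y_k]` with respect to the `x`-variables
(indexed by `Sum.inl`). -/
noncomputable def degInX {K : Type*} [CommSemiring K] {m k : ℕ}
    (p : MvPolynomial (Fin m ⊕ Fin k) K) : ℕ :=
  p.support.sup fun mo => ∑ i : Fin m, mo (Sum.inl i)

/-- Total degree of `p ∈ K[x_1,…,x_m,y_1,…,y_k]` with respect to the `y`-variables
(indexed by `Sum.inr`). -/
noncomputable def degInY {K : Type*} [CommSemiring K] {m k : ℕ}
    (p : MvPolynomial (Fin m ⊕ Fin k) K) : ℕ :=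
  p.support.sup fun mo => ∑ j : Fin k, mo (Sum.inr j)

open Polynomial in
theorem MvPolynomial.height_eq_of_isMaximal_fin {K : Type*} [Field K] (n : ℕ) :
    ∀ (M : Ideal (MvPolynomial (Fin n) K)) [M.IsMaximal], M.height = n := by
  induction n with
  | zero =>
    intro M hM
    have hM0 : M = ⊥ := by
      let e := (MvPolynomial.isEmptyRingEquiv K (Fin 0))
      have hf : IsField (MvPolynomial (Fin 0) K) := e.toMulEquiv.isField (Field.toIsField K)
      let := hf.toField
      exact (Ideal.eq_bot_or_top M).resolve_right hM.ne_top
    subst hM0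
    simp
  | succ n ih =>
    intro M hM
    let e := (MvPolynomial.finSuccEquiv K n).toRingEquiv
    let P := M.map e
    have hP : P.IsMaximal := Ideal.map_isMaximal_of_equiv e
    have hc : (P.comap (Polynomial.C : _ →+* (MvPolynomial (Fin n) K)[X])).IsMaximal :=
      Polynomial.isMaximal_comap_C_of_isJacobsonRing P
    have : P.LiesOver (P.comap (Polynomial.C : _ →+* (MvPolynomial (Fin n) K)[X])) := ⟨rfl⟩
    rw [← e.height_map M, Polynomial.height_eq_height_add_one (P.comap Polynomial.C) P, ih]
    simp

theorem MvPolynomial.height_eq_card_of_isMaximal {K σ : Type*} [Field K] [Finite σ]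
    (M : Ideal (MvPolynomial σ K)) [M.IsMaximal] : M.height = Nat.card σ := by
  let e := (MvPolynomial.renameEquiv K (Finite.equivFin σ)).toRingEquiv
  have : (M.map e).IsMaximal := Ideal.map_isMaximal_of_equiv e
  rw [← e.height_map M, MvPolynomial.height_eq_of_isMaximal_fin]

/-- If every prime between `J` and `M` contains the kernel of a surjection `f`, then the height of
`M` modulo `J` is at most the dimension of the target modulo the image of `J`. -/
theorem Ideal.height_map_quotient_le_of_forall_ker_le {R T : Type*} [CommRing R] [CommRing T]
    {J M : Ideal R} [M.IsPrime] (hJM : J ≤ M) (f : R →+* T) (hf : Function.Surjective f)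
    (h : ∀ Q : Ideal R, Q.IsPrime → J ≤ Q → Q ≤ M → RingHom.ker f ≤ Q) :
    ((M.map (Ideal.Quotient.mk J)).height : WithBot ℕ∞) ≤ ringKrullDim T := by
  have hM : (M.map (Ideal.Quotient.mk J)).IsPrime := Ideal.isPrime_map_quotientMk_of_isPrime hJM
  let x : PrimeSpectrum (R ⧸ J) := ⟨_, hM⟩
  have hx : (M.map (Ideal.Quotient.mk J)).height = Order.height x :=
    PrimeSpectrum.height_eq_orderHeight x
  rw [hx, Order.height_eq_krullDim_Iic]
  have hcm : (M.map (Ideal.Quotient.mk J)).comap (Ideal.Quotient.mk J) = M := by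
    rw [Ideal.comap_map_of_surjective _ Ideal.Quotient.mk_surjective, ← RingHom.ker_eq_comap_bot,
      Ideal.mk_ker, sup_eq_left.mpr hJM]
  have key : ∀ y : Set.Iic x, RingHom.ker f ≤ y.1.asIdeal.comap (Ideal.Quotient.mk J) := by
    intro y
    refine h _ inferInstance ?_ ?_
    · intro a ha
      rw [Ideal.mem_comap, Ideal.Quotient.eq_zero_iff_mem.mpr ha]
      exact zero_mem _
    · rw [← hcm]
      exact Ideal.comap_mono y.2
  let φ : Set.Iic x → PrimeSpectrum T := fun y ↦
    ⟨(y.1.asIdeal.comap (Ideal.Quotient.mk J)).map f, Ideal.map_isPrime_of_surjective hf (key y)⟩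
  have hφ : ∀ y, (φ y).asIdeal.comap f = y.1.asIdeal.comap (Ideal.Quotient.mk J) := by
    intro y
    change ((y.1.asIdeal.comap (Ideal.Quotient.mk J)).map f).comap f = _
    rw [Ideal.comap_map_of_surjective _ hf, ← RingHom.ker_eq_comap_bot, sup_eq_left.mpr (key y)]
  refine Order.krullDim_le_of_strictMono φ (Monotone.strictMono_of_injective ?_ ?_)
  · intro y z hyz
    exact Ideal.map_mono (Ideal.comap_mono hyz)
  · intro y z hyz
    have := hφ y
    rw [hyz, hφ z] at this
    exact Subtype.ext (PrimeSpectrum.ext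
      (Ideal.comap_injective_of_surjective _ Ideal.Quotient.mk_surjective this.symm))

open Polynomial in
/-- Let `I = (f₁(0), …, fₙ(0))` with `n + dim S/I` less than the height of `(M, X)`, where `M ⊇ I`.
Then some prime containing the `fᵢ` and contained in `(M, X)` does not contain `X`. -/
theorem Polynomial.exists_isPrime_X_notMem {S : Type*} [CommRing S] [IsNoetherianRing S]
    {n d : ℕ} (f : Fin n → S[X]) (M : Ideal S) [M.IsMaximal]
    (hM : ∀ i, (f i).coeff 0 ∈ M) (hd : M.height = (n + d : ℕ))
    (hdim : ringKrullDim (S ⧸ Ideal.span (Set.range fun i ↦ (f i).coeff 0)) ≤ d) :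
    ∃ Q : Ideal S[X], Q.IsPrime ∧ (∀ i, f i ∈ Q) ∧ Polynomial.X ∉ Q ∧
      Q ≤ M.comap Polynomial.constantCoeff := by
  by_contra! hcon
  set J := Ideal.span (Set.range f) with hJ
  set I := Ideal.span (Set.range fun i ↦ (f i).coeff 0) with hI
  set P := M.comap (Polynomial.constantCoeff (R := S)) with hP
  have hmax : P.IsMaximal := Ideal.comap_isMaximal_of_surjective _ constantCoeff_surjective
  have hlies : P.LiesOver M := ⟨by ext a; simp [hP]⟩
  have hJP : J ≤ P := by
    rw [hJ, Ideal.span_le]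
    rintro _ ⟨i, rfl⟩
    simpa [hP] using hM i
  let g : S[X] →+* S ⧸ I := (Ideal.Quotient.mk I).comp Polynomial.constantCoeff
  have h1 : ((P.map (Ideal.Quotient.mk J)).height : WithBot ℕ∞) ≤ d := by
    refine le_trans (Ideal.height_map_quotient_le_of_forall_ker_le hJP g
      (Ideal.Quotient.mk_surjective.comp constantCoeff_surjective) ?_) hdim
    intro Q hQ hJQ hQP
    have hX : Polynomial.X ∈ Q := by
      by_contra hX
      exact hcon Q hQ (fun i ↦ hJQ (Ideal.subset_span ⟨i, rfl⟩)) hX hQP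
    have hCI : ∀ a ∈ I, Polynomial.C a ∈ Q := by
      intro a ha
      have : I ≤ Q.comap Polynomial.C := by
        rw [hI, Ideal.span_le]
        rintro _ ⟨i, rfl⟩
        have h2 : f i ∈ Q := hJQ (Ideal.subset_span ⟨i, rfl⟩)
        rw [← Polynomial.divX_mul_X_add (f i)] at h2
        exact (Ideal.add_mem_iff_right _ (Q.mul_mem_left _ hX)).mp h2
      exact this ha
    intro a ha
    have : a.coeff 0 ∈ I := by
      simpa [g, RingHom.mem_ker, Ideal.Quotient.eq_zero_iff_mem] using ha
    rw [← Polynomial.divX_mul_X_add a]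
    exact Q.add_mem (Q.mul_mem_left _ hX) (hCI _ this)
  have h2 := Ideal.height_le_height_add_encard_of_subset (Set.range f) (p := P)
    (Set.range_subset_iff.mpr fun i ↦ by simpa [hP] using hM i)
  rw [Polynomial.height_eq_height_add_one M P, hd] at h2
  have h3 : (Set.range f).encard ≤ n := by
    rw [← Set.image_univ]
    refine (Set.encard_image_le _ _).trans ?_
    simp
  have h1' : (P.map (Ideal.Quotient.mk J)).height ≤ d := by exact_mod_cast h1
  have h4 : ((n + d : ℕ) : ℕ∞) + 1 ≤ d + n := h2.trans (add_le_add h1' h3)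
  have : n + d + 1 ≤ d + n := by exact_mod_cast h4
  omega

/-- The value at `x` of the form of degree `d i` whose coefficients are `c (i, ·)`. -/
noncomputable def formEval {ι Ω : Type*} [Fintype ι] [DecidableEq ι] [CommRing Ω] (d : ι → ℕ)
    (c : ι × (ι → ℕ) → Ω) (x : ι → Ω) (i : ι) : Ω :=
  ∑ α ∈ Finset.piAntidiag Finset.univ (d i), c (i, α) * ∏ j, x j ^ α j

theorem single_le_of_le {ι : Type*} [DecidableEq ι] {β : ι → ℕ} {j : ι} {n : ℕ} (h : n ≤ β j) :
    Pi.single j n ≤ β := by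
  intro l
  by_cases hl : l = j
  · subst hl; simpa using h
  · simp [Pi.single_eq_of_ne hl]

/-- The Macaulay matrix in degree `N`: the row of the monomial `β` holds the coefficients of the
multiple of the `cls β`-th generic form by `β` divided by the `d (cls β)`-th power of the
variable `cls β`. -/
noncomputable def macaulayMatrix {ι : Type*} (K : Type*) [Fintype ι] [DecidableEq ι]
    [Field K] (d : ι → ℕ) (N : ℕ) (cls : (ι → ℕ) → ι) :
    Matrix (Finset.piAntidiag (Finset.univ : Finset ι) N)
      (Finset.piAntidiag (Finset.univ : Finset ι) N) (MvPolynomial (ι × (ι → ℕ)) K) :=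
  Matrix.of fun β γ ↦
    if ∀ j, (β.1 - Pi.single (cls β.1) (d (cls β.1)) : ι → ℕ) j ≤ γ.1 j then
      X (cls β.1, γ.1 - (β.1 - Pi.single (cls β.1) (d (cls β.1)))) else 0

section Macaulay

variable {ι K : Type*} [Fintype ι] [DecidableEq ι] [Field K] {d : ι → ℕ} {N : ℕ}
  {cls : (ι → ℕ) → ι}

theorem aeval_det_macaulayMatrix_single {R : Type*} [CommRing R] [Algebra K R]
    (hcls : ∀ β ∈ Finset.piAntidiag Finset.univ N, d (cls β) ≤ β (cls β)) :
    aeval (fun v : ι × (ι → ℕ) ↦ if v.2 = Pi.single v.1 (d v.1) then (1 : R) else 0)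
      (macaulayMatrix K d N cls).det = 1 := by
  rw [AlgHom.map_det]
  refine (congrArg Matrix.det ?_).trans Matrix.det_one
  ext β γ
  have hβ : β.1 - Pi.single (cls β.1) (d (cls β.1)) + Pi.single (cls β.1) (d (cls β.1)) = β.1 :=
    tsub_add_cancel_of_le (single_le_of_le (hcls β.1 β.2))
  rw [AlgHom.mapMatrix_apply, Matrix.map_apply, macaulayMatrix, Matrix.of_apply, Matrix.one_apply]
  set δ := β.1 - Pi.single (cls β.1) (d (cls β.1)) with hδ
  by_cases hβγ : β = γ
  · subst hβγ
    rw [if_pos rfl, if_pos fun j ↦ by exact Nat.sub_le _ _, aeval_X, if_pos]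
    exact tsub_eq_of_eq_add_rev hβ.symm
  · rw [if_neg hβγ]
    split_ifs with h
    · rw [aeval_X, if_neg]
      intro h1
      simp only at h1
      refine hβγ (Subtype.ext ?_)
      rw [← hβ, ← h1, add_tsub_cancel_of_le (show δ ≤ γ.1 from h)]
    · rw [map_zero]

theorem aeval_det_macaulayMatrix_eq_zero {Ω : Type*} [CommRing Ω] [Algebra K Ω]
    (hcls : ∀ β ∈ Finset.piAntidiag Finset.univ N, d (cls β) ≤ β (cls β))
    (c : ι × (ι → ℕ) → Ω) (x : ι → Ω) {o : ι} (ho : x o = 1) (h : ∀ i, formEval d c x i = 0) :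
    aeval c (macaulayMatrix K d N cls).det = 0 := by
  rw [AlgHom.map_det]
  set A := (aeval c).mapMatrix (macaulayMatrix K d N cls) with hA
  let v : Finset.piAntidiag (Finset.univ : Finset ι) N → Ω := fun γ ↦ ∏ j, x j ^ γ.1 j
  have hAv : A.mulVec v = 0 := by
    ext β
    set δ := β.1 - Pi.single (cls β.1) (d (cls β.1)) with hδ
    have hβ : δ + Pi.single (cls β.1) (d (cls β.1)) = β.1 :=
      tsub_add_cancel_of_le (single_le_of_le (hcls β.1 β.2))
    have hsum : ∑ j, δ j + d (cls β.1) = N := by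
      have h1 := (Finset.mem_piAntidiag.mp β.2).1
      rw [← hβ] at h1
      simpa [Finset.sum_add_distrib] using h1
    have : A.mulVec v β = (∏ j, x j ^ δ j) * formEval d c x (cls β.1) := by
      have hG : A.mulVec v β = ∑ γ : Finset.piAntidiag (Finset.univ : Finset ι) N,
          (if ∀ j, δ j ≤ γ.1 j then c (cls β.1, γ.1 - δ) else 0) * ∏ j, x j ^ γ.1 j := by
        refine Finset.sum_congr rfl fun γ _ ↦ ?_
        change A β γ * _ = _
        rw [hA, AlgHom.mapMatrix_apply, Matrix.map_apply, macaulayMatrix, Matrix.of_apply, apply_ite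
          (aeval c), aeval_X, map_zero]
      rw [hG, Finset.sum_coe_sort _ fun γ : ι → ℕ ↦
        (if ∀ j, δ j ≤ γ j then c (cls β.1, γ - δ) else 0) * ∏ j, x j ^ γ j, formEval,
        Finset.mul_sum]
      symm
      refine Finset.sum_of_injOn (fun α ↦ δ + α) (add_right_injective δ).injOn ?_ ?_ ?_
      · intro α hα
        simp only [Finset.mem_coe, Finset.mem_piAntidiag, Finset.mem_univ, implies_true,
          and_true] at hα ⊢
        simp only [Pi.add_apply, Finset.sum_add_distrib, hα, hsum]
      · intro γ hγ hγ'
        rw [if_neg, zero_mul]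
        intro hle
        refine hγ' ⟨γ - δ, ?_, add_tsub_cancel_of_le (show δ ≤ γ from hle)⟩
        simp only [Finset.mem_coe, Finset.mem_piAntidiag, Finset.mem_univ, implies_true,
          and_true] at hγ ⊢
        rw [← add_tsub_cancel_of_le (show δ ≤ γ from hle)] at hγ
        have h1 : ∑ j, δ j + ∑ j, (γ - δ) j = N := by rw [← hγ, ← Finset.sum_add_distrib]; rfl
        change ∑ j, (γ - δ) j = _
        omega
      · intro α _
        rw [if_pos fun j ↦ by exact Nat.le_add_right _ _, add_tsub_cancel_left]
        simp only [Pi.add_apply, pow_add, Finset.prod_mul_distrib]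
        ring
    rw [this, h, mul_zero]; rfl
  have h0 : A.det • v = 0 := by
    rw [← Matrix.one_mulVec v, ← Matrix.smul_mulVec, ← Matrix.adjugate_mul, ← Matrix.mulVec_mulVec,
      hAv, Matrix.mulVec_zero]
  have h1 := congrFun h0 ⟨Pi.single o N, by simp [Finset.mem_piAntidiag]⟩
  have h2 : ∏ j, x j ^ (Pi.single o N : ι → ℕ) j = 1 := by
    refine Finset.prod_eq_one fun j _ ↦ ?_
    by_cases hj : j = o
    · subst hj; simp [ho]
    · simp [Pi.single_eq_of_ne hj]
  simpa [v, h2] using h1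

/-- Multiply the coefficients of the `i`-th generic form by a new variable. -/
noncomputable def scaleHom (K : Type*) [Field K] (i : ι) :
    MvPolynomial (ι × (ι → ℕ)) K →ₐ[K] Polynomial (MvPolynomial (ι × (ι → ℕ)) K) :=
  aeval fun v ↦ if v.1 = i then Polynomial.C (X v) * Polynomial.X else Polynomial.C (X v)

theorem natDegree_scaleHom_det_macaulayMatrix_le (i : ι) :
    (scaleHom K i (macaulayMatrix K d N cls).det).natDegree ≤
      ((Finset.piAntidiag Finset.univ N).filter fun β ↦ cls β = i).card := by
  classical
  rw [AlgHom.map_det, Matrix.det_apply]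
  refine Polynomial.natDegree_sum_le_of_forall_le _ _ fun σ _ ↦ ?_
  have hs : ∀ (u : ℤˣ) (p : Polynomial (MvPolynomial (ι × (ι → ℕ)) K)),
      (u • p).natDegree = p.natDegree := by
    intro u p
    rcases Int.units_eq_one_or u with rfl | rfl <;> simp
  rw [hs]
  refine (Polynomial.natDegree_prod_le _ _).trans ?_
  calc _ ≤ ∑ β, (if cls (σ β).1 = i then 1 else 0) := by
        refine Finset.sum_le_sum fun β _ ↦ ?_
        rw [AlgHom.mapMatrix_apply, Matrix.map_apply, macaulayMatrix, Matrix.of_apply]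
        split_ifs with h1 h2
        · rw [scaleHom, aeval_X, if_pos h2]
          exact (Polynomial.natDegree_C_mul_le _ _).trans Polynomial.natDegree_X_le
        · rw [scaleHom, aeval_X, if_neg h2, Polynomial.natDegree_C]
        all_goals simp
    _ = ∑ β : Finset.piAntidiag (Finset.univ : Finset ι) N, (if cls β.1 = i then 1 else 0) :=
        Equiv.sum_comp σ fun β ↦ if cls β.1 = i then 1 else 0
    _ = _ := by
        rw [Finset.sum_coe_sort _ fun β : ι → ℕ ↦ if cls β = i then 1 else 0, Finset.card_filter]

/-- Every monomial of degree `∑ (d j - 1) + 1` is divisible by some `d j`-th power of a variable,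
and only few of them force the choice `j = i`. -/
theorem exists_macaulay_class (hN : N = ∑ j, (d j - 1) + 1) (i : ι) :
    ∃ cls : (ι → ℕ) → ι, (∀ β ∈ Finset.piAntidiag Finset.univ N, d (cls β) ≤ β (cls β)) ∧
      ((Finset.piAntidiag Finset.univ N).filter fun β ↦ cls β = i).card ≤
        ∏ j ∈ Finset.univ.erase i, d j := by
  classical
  have hex : ∀ β : ι → ℕ, ∃ j, β ∈ Finset.piAntidiag Finset.univ N →
      d j ≤ β j ∧ (j = i → ∀ l, l ≠ i → β l < d l) := by
    intro β
    by_cases hβ : β ∈ Finset.piAntidiag Finset.univ N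
    · by_cases h : ∃ j, j ≠ i ∧ d j ≤ β j
      · obtain ⟨j, hj, hjd⟩ := h
        exact ⟨j, fun _ ↦ ⟨hjd, fun h ↦ absurd h hj⟩⟩
      · push Not at h
        refine ⟨i, fun _ ↦ ⟨?_, fun _ ↦ h⟩⟩
        by_contra hi
        push Not at hi
        have h1 : ∑ j, β j ≤ ∑ j, (d j - 1) := by
          refine Finset.sum_le_sum fun j _ ↦ ?_
          by_cases hj : j = i
          · subst hj; omega
          · have := h j hj; omega
        have h2 : ∑ j, β j = N := (Finset.mem_piAntidiag.mp hβ).1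
        omega
    · exact ⟨i, fun h ↦ absurd h hβ⟩
  choose cls hcls using hex
  refine ⟨cls, fun β hβ ↦ (hcls β hβ).1, ?_⟩
  let t : Finset (ι → ℕ) := Fintype.piFinset fun j ↦ if j = i then {0} else Finset.range (d j)
  have ht : t.card = ∏ j ∈ Finset.univ.erase i, d j := by
    rw [Fintype.card_piFinset, ← Finset.mul_prod_erase _ _ (Finset.mem_univ i)]
    simp only [if_true, Finset.card_singleton, one_mul]
    refine Finset.prod_congr rfl fun j hj ↦ ?_
    simp [Finset.ne_of_mem_erase hj]
  rw [← ht]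
  refine Finset.card_le_card_of_injOn (fun β ↦ Function.update β i 0) ?_ ?_
  · intro β hβ
    simp only [Finset.coe_filter, Set.mem_ofPred_eq] at hβ
    simp only [t, Finset.mem_coe, Fintype.mem_piFinset]
    intro j
    by_cases hj : j = i
    · subst hj; simp
    · simpa [hj] using (hcls β hβ.1).2 hβ.2 j hj
  · intro β hβ γ hγ hβγ
    simp only [Finset.coe_filter, Set.mem_ofPred_eq, Finset.mem_piAntidiag] at hβ hγ
    have hne : ∀ j, j ≠ i → β j = γ j := by
      intro j hj
      simpa [hj] using congrFun hβγ j
    funext j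
    by_cases hj : j = i
    · subst hj
      have h1 := hβ.1.1
      have h2 := hγ.1.1
      rw [← Finset.add_sum_erase _ _ (Finset.mem_univ j)] at h1 h2
      have h3 : ∑ l ∈ Finset.univ.erase j, β l = ∑ l ∈ Finset.univ.erase j, γ l :=
        Finset.sum_congr rfl fun l hl ↦ hne l (Finset.ne_of_mem_erase hl)
      omega
    · exact hne j hj

end Macaulay
section GenericElimination

variable {ι K : Type*} [Fintype ι] [DecidableEq ι] [Field K] {d : ι → ℕ} {o : ι}

theorem map_formEval {Ω Ω' : Type*} [CommRing Ω] [CommRing Ω'] (f : Ω →+* Ω')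
    (c : ι × (ι → ℕ) → Ω) (x : ι → Ω) (i : ι) :
    f (formEval d c x i) = formEval d (fun v ↦ f (c v)) (fun j ↦ f (x j)) i := by
  simp [formEval, map_sum, map_mul, map_prod, map_pow]

theorem prod_pow_single {Ω : Type*} [CommRing Ω] {x : ι → Ω} (ho : x o = 1) (n : ℕ) :
    ∏ j, x j ^ (Pi.single o n : ι → ℕ) j = 1 := by
  refine Finset.prod_eq_one fun j _ ↦ ?_
  by_cases hj : j = o
  · subst hj; simp [ho]
  · simp [Pi.single_eq_of_ne hj]

theorem formEval_eq_add_sum_erase {Ω : Type*} [CommRing Ω] (c : ι × (ι → ℕ) → Ω) {x : ι → Ω}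
    (ho : x o = 1) (i : ι) :
    formEval d c x i = c (i, Pi.single o (d i)) +
      ∑ α ∈ (Finset.piAntidiag Finset.univ (d i)).erase (Pi.single o (d i)),
        c (i, α) * ∏ j, x j ^ α j := by
  rw [formEval, ← Finset.add_sum_erase _ _ (a := Pi.single o (d i))
    (by simp [Finset.mem_piAntidiag]), prod_pow_single ho, mul_one]

/-- The coefficients of the generic forms vanishing at a generic point whose coordinate `o` is `1`:
the coefficient of the power of the variable `o` is expressed through the others. -/
noncomputable def genericZero (K : Type*) [Field K] (d : ι → ℕ) (o : ι) :
    MvPolynomial (ι × (ι → ℕ)) K →ₐ[K] MvPolynomial ((ι × (ι → ℕ)) ⊕ ι) K :=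
  aeval fun v ↦ if v.2 = Pi.single o (d v.1) then
    -∑ α ∈ (Finset.piAntidiag Finset.univ (d v.1)).erase (Pi.single o (d v.1)),
      X (Sum.inl (v.1, α)) * ∏ j, (if j = o then 1 else X (Sum.inr j)) ^ α j
    else X (Sum.inl v)

theorem genericZero_eq_zero {F : MvPolynomial (ι × (ι → ℕ)) K}
    (hF : ∀ (c : ι × (ι → ℕ) → MvPolynomial ((ι × (ι → ℕ)) ⊕ ι) K)
      (x : ι → MvPolynomial ((ι × (ι → ℕ)) ⊕ ι) K), x o = 1 → (∀ i, formEval d c x i = 0) →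
      aeval c F = 0) :
    genericZero K d o F = 0 := by
  have ho : (fun j ↦ if j = o then 1 else X (Sum.inr j) :
      ι → MvPolynomial ((ι × (ι → ℕ)) ⊕ ι) K) o = 1 := if_pos rfl
  refine hF _ (fun j ↦ if j = o then 1 else X (Sum.inr j)) ho fun i ↦ ?_
  refine (formEval_eq_add_sum_erase (o := o) (x := fun j ↦ if j = o then 1 else X (Sum.inr j))
    _ ho i).trans ?_
  rw [if_pos rfl, neg_add_eq_zero]
  refine Finset.sum_congr rfl fun α hα ↦ ?_
  rw [if_neg (Finset.ne_of_mem_erase hα)]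

theorem aeval_eq_zero_of_genericZero {Ω : Type*} [CommRing Ω] [Algebra K Ω]
    {F : MvPolynomial (ι × (ι → ℕ)) K} (hF : genericZero K d o F = 0)
    (c : ι × (ι → ℕ) → Ω) (x : ι → Ω) (ho : x o = 1) (h : ∀ i, formEval d c x i = 0) :
    aeval c F = 0 := by
  have hcomp : (aeval (Sum.elim c x)).comp (genericZero K d o) = aeval c := by
    refine MvPolynomial.algHom_ext fun v ↦ ?_
    obtain ⟨i, α⟩ := v
    rw [AlgHom.comp_apply, genericZero, aeval_X, aeval_X]
    split_ifs with hα
    · simp only at hα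
      have h1 := h i
      rw [formEval_eq_add_sum_erase c ho] at h1
      rw [hα, eq_neg_of_add_eq_zero_left h1, map_neg, map_sum, neg_inj]
      refine Finset.sum_congr rfl fun γ _ ↦ ?_
      rw [map_mul, aeval_X, Sum.elim_inl, map_prod]
      congr 1
      refine Finset.prod_congr rfl fun j _ ↦ ?_
      rw [map_pow]
      congr 1
      split_ifs with hj
      · rw [map_one, hj, ho]
      · rw [aeval_X, Sum.elim_inr]
    · rw [aeval_X, Sum.elim_inl]
  rw [← hcomp, AlgHom.comp_apply, hF, map_zero]

theorem aeval_mem_of_genericZero {Ω : Type*} [CommRing Ω] [Algebra K Ω] (Q : Ideal Ω)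
    {F : MvPolynomial (ι × (ι → ℕ)) K} (hF : genericZero K d o F = 0)
    (c : ι × (ι → ℕ) → Ω) (x : ι → Ω) (ho : x o = 1) (h : ∀ i, formEval d c x i ∈ Q) :
    aeval c F ∈ Q := by
  rw [← Ideal.Quotient.eq_zero_iff_mem, ← Ideal.Quotient.mkₐ_eq_mk K]
  refine (comp_aeval_apply c (Ideal.Quotient.mkₐ K Q) F).trans ?_
  refine aeval_eq_zero_of_genericZero hF _ (fun j ↦ Ideal.Quotient.mk Q (x j))
    (by rw [ho, map_one]) fun i ↦ ?_
  exact (map_formEval (Ideal.Quotient.mk Q) c x i).symm.trans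
    (Ideal.Quotient.eq_zero_iff_mem.mpr (h i))

/-- Coefficients of the forms `x i * x o ^ (d i - 1)` for `i ≠ o`. -/
def linearCoeff (R : Type*) [CommRing R] (d : ι → ℕ) (o : ι) (v : ι × (ι → ℕ)) : R :=
  if v.1 ≠ o ∧ v.2 = Pi.single v.1 1 + Pi.single o (d v.1 - 1) then 1 else 0

theorem formEval_linearCoeff {Ω : Type*} [CommRing Ω] {x : ι → Ω} (hd : ∀ i, 1 ≤ d i)
    (ho : x o = 1) {i : ι} (hi : i ≠ o) : formEval d (linearCoeff Ω d o) x i = x i := by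
  rw [formEval, Finset.sum_eq_single (Pi.single i 1 + Pi.single o (d i - 1))]
  · rw [linearCoeff, if_pos ⟨hi, rfl⟩, one_mul]
    simp only [Pi.add_apply, pow_add, Finset.prod_mul_distrib, prod_pow_single ho, mul_one]
    rw [Finset.prod_eq_single i]
    · simp
    · intro j _ hj
      simp [Pi.single_eq_of_ne hj]
    · simp
  · intro α _ hα
    rw [linearCoeff, if_neg fun h ↦ hα h.2, zero_mul]
  · intro h
    refine absurd ?_ h
    simp only [Finset.mem_piAntidiag, Pi.add_apply, Finset.sum_add_distrib, Finset.sum_pi_single',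
      Finset.mem_univ, if_true, implies_true, and_true]
    have := hd i
    omega

/-- Successive approximations, in powers of the perturbation parameter, of the zero of the system
`x i + X * (generic form i) = 0`, where `x o = 1`. -/
noncomputable def approxZero (K : Type*) [Field K] (d : ι → ℕ) (o : ι) :
    ℕ → ι → Polynomial (MvPolynomial (ι × (ι → ℕ)) K)
  | 0 => fun j ↦ if j = o then 1 else 0
  | n + 1 => fun j ↦ if j = o then 1 else
      -Polynomial.X * formEval d (fun v ↦ Polynomial.C (X v)) (approxZero K d o n) j

theorem approxZero_succ (n : ℕ) (j : ι) : approxZero K d o (n + 1) j = if j = o then 1 else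
    -Polynomial.X * formEval d (fun v ↦ Polynomial.C (X v)) (approxZero K d o n) j :=
  rfl

theorem approxZero_self (n : ℕ) : approxZero K d o n o = 1 := by
  cases n <;> simp [approxZero]

theorem X_pow_dvd_approxZero_sub (n : ℕ) (j : ι) :
    Polynomial.X ^ n ∣ approxZero K d o (n + 1) j - approxZero K d o n j := by
  induction n generalizing j with
  | zero => simp
  | succ n ih =>
    rw [approxZero_succ (n + 1), approxZero_succ n]
    split_ifs with hj
    · simp
    · rw [← mul_sub, pow_succ']
      refine mul_dvd_mul ⟨-1, by ring⟩ ?_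
      rw [← Ideal.mem_span_singleton, ← Ideal.Quotient.eq]
      refine (map_formEval (Ideal.Quotient.mk _) _ _ j).trans
        (Eq.trans ?_ (map_formEval (Ideal.Quotient.mk _) _ _ j).symm)
      congr 1
      funext l
      rw [Ideal.Quotient.eq, Ideal.mem_span_singleton]
      exact ih l

/-- The generic forms other than the `o`-th one have a common zero, so a polynomial vanishing at the
coefficients of solvable systems involves the leading coefficient of the `o`-th form. -/
theorem eq_zero_of_genericZero_of_notMem_vars (hd : ∀ i, 1 ≤ d i)
    {F : MvPolynomial (ι × (ι → ℕ)) K} (hF : genericZero K d o F = 0)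
    (hv : (o, Pi.single o (d o)) ∉ F.vars) : F = 0 := by
  let c : ι × (ι → ℕ) → Polynomial (MvPolynomial (ι × (ι → ℕ)) K) := fun v ↦
    Polynomial.X * Polynomial.C (X v) + linearCoeff _ d o v
  have hform : ∀ (x : ι → Polynomial (MvPolynomial (ι × (ι → ℕ)) K)) i, formEval d c x i =
      Polynomial.X * formEval d (fun v ↦ Polynomial.C (X v)) x i +
        formEval d (linearCoeff _ d o) x i := by
    intro x i
    simp only [formEval, c, add_mul, Finset.sum_add_distrib, Finset.mul_sum, mul_assoc]
  have hdvd : ∀ n : ℕ, Polynomial.X ^ n ∣ aeval c F := by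
    intro n
    set x := approxZero K d o n
    let c' : ι × (ι → ℕ) → Polynomial (MvPolynomial (ι × (ι → ℕ)) K) :=
      Function.update c (o, Pi.single o (d o)) (c (o, Pi.single o (d o)) - formEval d c x o)
    have hcc' : aeval c F = aeval c' F := by
      refine MvPolynomial.eval₂Hom_congr' rfl (fun v hvF _ ↦ ?_) rfl
      have : v ≠ (o, Pi.single o (d o)) := fun h ↦ hv (h ▸ hvF)
      simp [c', this]
    have hzero : ∀ i, Polynomial.X ^ n ∣ formEval d c' x i := by
      intro i
      by_cases hi : i = o
      · subst hi
        have h1 : formEval d c' x i = 0 := by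
          have h2 := formEval_eq_add_sum_erase (d := d) c (x := x) (approxZero_self n) i
          rw [formEval_eq_add_sum_erase c' (approxZero_self n)]
          have h3 : ∑ α ∈ (Finset.piAntidiag Finset.univ (d i)).erase (Pi.single i (d i)),
              c' (i, α) * ∏ j, x j ^ α j =
              ∑ α ∈ (Finset.piAntidiag Finset.univ (d i)).erase (Pi.single i (d i)),
              c (i, α) * ∏ j, x j ^ α j := by
            refine Finset.sum_congr rfl fun α hα ↦ ?_
            have : (i, α) ≠ (i, Pi.single i (d i)) := fun h ↦
              Finset.ne_of_mem_erase hα (Prod.ext_iff.mp h).2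
            simp [c', this]
          rw [h3]
          simp only [c', Function.update_self]
          rw [h2]
          ring
        rw [h1]
        exact dvd_zero _
      · have h1 : formEval d c' x i = formEval d c x i := by
          refine Finset.sum_congr rfl fun α _ ↦ ?_
          have : (i, α) ≠ (o, Pi.single o (d o)) := fun h ↦ hi (Prod.ext_iff.mp h).1
          simp [c', this]
        rw [h1, hform, formEval_linearCoeff hd (approxZero_self n) hi, ← dvd_neg]
        convert X_pow_dvd_approxZero_sub (K := K) (d := d) (o := o) n i using 1
        rw [approxZero_succ, if_neg hi]
        ring
    rw [hcc', ← Ideal.mem_span_singleton]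
    exact aeval_mem_of_genericZero _ hF c' x (approxZero_self n) fun i ↦
      Ideal.mem_span_singleton.mpr (hzero i)
  have h0 : aeval c F = 0 := by
    ext1 n
    exact Polynomial.X_pow_dvd_iff.mp (hdvd (n + 1)) n (Nat.lt_succ_self n)
  let g : MvPolynomial (ι × (ι → ℕ)) K →ₐ[K] MvPolynomial (ι × (ι → ℕ)) K :=
    aeval fun v ↦ X v - linearCoeff _ d o v
  let h : Polynomial (MvPolynomial (ι × (ι → ℕ)) K) →+* MvPolynomial (ι × (ι → ℕ)) K :=
    Polynomial.eval₂RingHom g.toRingHom 1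
  have h1 : h.comp (aeval c).toRingHom = RingHom.id _ := by
    refine MvPolynomial.ringHom_ext (fun r ↦ ?_) fun v ↦ ?_
    · change h (aeval c (MvPolynomial.C r)) = MvPolynomial.C r
      rw [aeval_C]
      change h (Polynomial.C (MvPolynomial.C r)) = _
      change Polynomial.eval₂ _ _ (Polynomial.C _) = _
      rw [Polynomial.eval₂_C]
      exact g.commutes r
    · change h (aeval c (X v)) = X v
      rw [aeval_X]
      have h2 : h (linearCoeff _ d o v) = linearCoeff _ d o v := by
        simp only [linearCoeff]
        split_ifs
        · exact map_one _
        · exact map_zero _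
      have h3 : h (Polynomial.X * Polynomial.C (X v)) = X v - linearCoeff _ d o v := by
        change Polynomial.eval₂ _ _ _ = _
        rw [Polynomial.eval₂_mul, Polynomial.eval₂_X, Polynomial.eval₂_C, one_mul]
        exact aeval_X _ _
      rw [map_add, h2, h3, sub_add_cancel]
  have h2 := RingHom.congr_fun h1 F
  simp only [RingHom.comp_apply, RingHom.id_apply] at h2
  rw [← h2]
  change h (aeval c F) = 0
  rw [h0, map_zero]

end GenericElimination

theorem Polynomial.dvd_of_prime_of_mem {A : Type*} [CommRing A] [IsDomain A]
    {J : Ideal (Polynomial A)} (hJ : ∀ a, Polynomial.C a ∈ J → a = 0) {R F : Polynomial A}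
    (hR : Prime R) (hRJ : R ∈ J) (hF : F ∈ J) : R ∣ F := by
  classical
  have hex : ∃ n, ∃ G ∈ J, G ≠ 0 ∧ G.natDegree = n := ⟨_, R, hRJ, hR.ne_zero, rfl⟩
  obtain ⟨G, hGJ, hG0, hGn⟩ := Nat.find_spec hex
  have hmin : ∀ F ∈ J, F ≠ 0 → G.degree ≤ F.degree := fun F hF hF0 ↦
    by
      rw [Polynomial.degree_eq_natDegree hG0, Polynomial.degree_eq_natDegree hF0]
      exact_mod_cast hGn.trans_le (Nat.find_min' hex ⟨F, hF, hF0, rfl⟩)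
  have hdiv : ∀ n : ℕ, ∀ F ∈ J, F.degree < n → ∃ a ≠ 0, G ∣ Polynomial.C a * F := by
    intro n
    induction n with
    | zero =>
      intro F _ hFn
      refine ⟨1, one_ne_zero, ?_⟩
      have : F = 0 := by
        rw [← Polynomial.degree_eq_bot]
        exact Nat.WithBot.lt_zero_iff.mp (by simpa using hFn)
      simp [this]
    | succ n ih =>
      intro F hFJ hFn
      by_cases hF0 : F = 0
      · exact ⟨1, one_ne_zero, by simp [hF0]⟩
      have hle := Polynomial.natDegree_le_natDegree (hmin F hFJ hF0)
      set q := Polynomial.C F.leadingCoeff * Polynomial.X ^ (F.natDegree - G.natDegree) with hq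
      have hlF : F.leadingCoeff ≠ 0 := Polynomial.leadingCoeff_ne_zero.mpr hF0
      have hlG : G.leadingCoeff ≠ 0 := Polynomial.leadingCoeff_ne_zero.mpr hG0
      have hd1 : (Polynomial.C G.leadingCoeff * F).degree = F.degree := by
        rw [Polynomial.degree_mul, Polynomial.degree_C hlG, zero_add]
      have hd2 : (q * G).degree = F.degree := by
        rw [hq, Polynomial.degree_mul, Polynomial.degree_C_mul_X_pow _ hlF,
          Polynomial.degree_eq_natDegree hG0, Polynomial.degree_eq_natDegree hF0]
        exact_mod_cast Nat.sub_add_cancel hle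
      have hlt : (Polynomial.C G.leadingCoeff * F - q * G).degree < F.degree := by
        rw [← hd1]
        refine Polynomial.degree_sub_lt_left (hd1.trans hd2.symm)
          (mul_ne_zero (Polynomial.C_ne_zero.mpr hlG) hF0) ?_
        rw [Polynomial.leadingCoeff_mul, Polynomial.leadingCoeff_mul, hq,
          Polynomial.leadingCoeff_C, Polynomial.leadingCoeff_C_mul_X_pow, mul_comm]
      obtain ⟨a, ha, haG⟩ := ih _ (J.sub_mem (J.mul_mem_left _ hFJ) (J.mul_mem_left _ hGJ))
        (hlt.trans_le (by
          rw [Polynomial.degree_eq_natDegree hF0] at hFn ⊢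
          have : F.natDegree < n + 1 := by exact_mod_cast hFn
          exact_mod_cast Nat.lt_succ_iff.mp this))
      refine ⟨a * G.leadingCoeff, mul_ne_zero ha hlG, ?_⟩
      rw [mul_sub] at haG
      have h2 := (dvd_sub_left (Dvd.intro_left (Polynomial.C a * q) (by ring))).mp haG
      rwa [Polynomial.C_mul, mul_assoc]
  have hdiv' : ∀ F ∈ J, ∃ a ≠ 0, G ∣ Polynomial.C a * F := fun F hF ↦
    hdiv (F.natDegree + 1) F hF (Polynomial.degree_le_natDegree.trans_lt
      (by exact_mod_cast Nat.lt_succ_self _))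
  have hRG : R ∣ G := by
    obtain ⟨b, hb, q, hq⟩ := hdiv' R hRJ
    refine (hR.dvd_or_dvd (Dvd.intro_left _ hq)).resolve_right ?_
    rintro ⟨s, rfl⟩
    refine hb (hJ b ?_)
    have : Polynomial.C b = G * s := by
      refine mul_right_cancel₀ hR.ne_zero ?_
      rw [hq]
      ring
    exact this ▸ J.mul_mem_right _ hGJ
  obtain ⟨a, ha, haG⟩ := hdiv' F hF
  refine (hR.dvd_or_dvd (hRG.trans haG)).resolve_left ?_
  rintro ⟨t, ht⟩
  exact ha (hJ a (ht ▸ J.mul_mem_right _ hRJ))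

theorem MvPolynomial.dvd_of_prime_of_mem {σ K : Type*} [Field K] (v₀ : σ)
    {J : Ideal (MvPolynomial σ K)} (hJ : ∀ F ∈ J, v₀ ∉ F.vars → F = 0) {R F : MvPolynomial σ K}
    (hR : Prime R) (hRJ : R ∈ J) (hF : F ∈ J) : R ∣ F := by
  classical
  let e : MvPolynomial σ K ≃ₐ[K] Polynomial (MvPolynomial {v // v ≠ v₀} K) :=
    (renameEquiv K (Equiv.optionSubtypeNe v₀).symm).trans (optionEquivLeft K _)
  have he : ∀ a, e (rename Subtype.val a) = Polynomial.C a := by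
    intro a
    have : e.toAlgHom.comp (rename (Subtype.val : {v // v ≠ v₀} → σ)) =
        IsScalarTower.toAlgHom K (MvPolynomial {v // v ≠ v₀} K) _ := by
      refine MvPolynomial.algHom_ext fun v ↦ ?_
      simp [e, Equiv.optionSubtypeNe_symm_of_ne v.2, optionEquivLeft_X_some]
    exact DFunLike.congr_fun this a
  have hmem : ∀ {P}, P ∈ J → e P ∈ J.comap (e.symm : _ →+* MvPolynomial σ K) := by
    intro P hP
    simpa [Ideal.mem_comap] using hP
  have := Polynomial.dvd_of_prime_of_mem (J := J.comap (e.symm : _ →+* MvPolynomial σ K))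
    (R := e R) (F := e F) (fun a ha ↦ ?_)
    ((MulEquiv.prime_iff e.toMulEquiv).mpr hR) (hmem hRJ) (hmem hF)
  · exact (map_dvd_iff e).mp this
  · rw [← he, Ideal.mem_comap] at ha
    have h1 : rename Subtype.val a ∈ J := by simpa using ha
    refine rename_injective _ Subtype.val_injective ((hJ _ h1 fun h ↦ ?_).trans (map_zero _).symm)
    obtain ⟨v, _, hv⟩ := Finset.mem_image.mp (vars_rename _ _ h)
    exact v.2 hv

section Resultant

variable {ι K : Type*} [Fintype ι] [DecidableEq ι] [Field K] {d : ι → ℕ} {o : ι}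

theorem scaleHom_injective {ι : Type*} [DecidableEq ι] (i : ι) :
    Function.Injective (scaleHom K i) := by
  have h : ((Polynomial.aeval (1 : MvPolynomial (ι × (ι → ℕ)) K)).restrictScalars K).comp
      (scaleHom K i) = AlgHom.id K _ := by
    refine MvPolynomial.algHom_ext fun v ↦ ?_
    rw [AlgHom.comp_apply, scaleHom, aeval_X]
    split_ifs <;> simp
  exact Function.LeftInverse.injective (g := ((Polynomial.aeval
    (1 : MvPolynomial (ι × (ι → ℕ)) K)).restrictScalars K)) (DFunLike.congr_fun h)

/-- Existence of the multivariate resultant of generic forms of degrees `d`. -/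
theorem exists_resultant (hd : ∀ i, 1 ≤ d i) (o : ι) :
    ∃ R : MvPolynomial (ι × (ι → ℕ)) K, genericZero K d o R = 0 ∧
      (∀ i, (scaleHom K i R).natDegree ≤ ∏ j ∈ Finset.univ.erase i, d j) ∧
      aeval (fun v : ι × (ι → ℕ) ↦ if v.2 = Pi.single v.1 (d v.1) then (1 : K) else 0) R ≠ 0 := by
  choose cls hcls hcard using exists_macaulay_class (d := d) rfl
  set Δ : ι → MvPolynomial (ι × (ι → ℕ)) K := fun i ↦ (macaulayMatrix K d _ (cls i)).det with hΔ
  have hsp : ∀ i, aeval (fun v : ι × (ι → ℕ) ↦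
      if v.2 = Pi.single v.1 (d v.1) then (1 : K) else 0) (Δ i) = 1 := fun i ↦
    aeval_det_macaulayMatrix_single (hcls i)
  have hΔ0 : ∀ i, Δ i ≠ 0 := fun i h ↦ by simpa [h] using hsp i
  have hmem : ∀ i, Δ i ∈ RingHom.ker (genericZero K d o) := fun i ↦
    genericZero_eq_zero fun c x ho hx ↦ aeval_det_macaulayMatrix_eq_zero (hcls i) c x ho hx
  have hbot : RingHom.ker (genericZero K d o) ≠ ⊥ := fun h ↦ hΔ0 o ((h ▸ hmem o : _ ∈ ⊥))
  obtain ⟨R, hRJ, hR⟩ := (RingHom.ker_isPrime (genericZero K d o)).exists_mem_prime_of_ne_bot hbot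
  have hdvd : ∀ i, R ∣ Δ i := fun i ↦ MvPolynomial.dvd_of_prime_of_mem (o, Pi.single o (d o))
    (fun F hF hv ↦ eq_zero_of_genericZero_of_notMem_vars hd hF hv) hR hRJ (hmem i)
  refine ⟨R, hRJ, fun i ↦ ?_, fun h ↦ ?_⟩
  · refine (Polynomial.natDegree_le_of_dvd (map_dvd (scaleHom K i) (hdvd i)) ?_).trans
      ((natDegree_scaleHom_det_macaulayMatrix_le i).trans (hcard i))
    rw [Ne, map_eq_zero_iff _ (scaleHom_injective i)]
    exact hΔ0 i
  · have := map_dvd (aeval fun v : ι × (ι → ℕ) ↦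
      if v.2 = Pi.single v.1 (d v.1) then (1 : K) else 0) (hdvd o)
    rw [h, hsp, zero_dvd_iff] at this
    exact one_ne_zero this

end Resultant

section Specialization

theorem sum_filter_le_natDegree_scaleHom {ι K : Type*} [DecidableEq ι] [Field K] (i : ι)
    {R : MvPolynomial (ι × (ι → ℕ)) K} {s : ι × (ι → ℕ) →₀ ℕ} (hs : s ∈ R.support) :
    ∑ v ∈ s.support with v.1 = i, s v ≤ (scaleHom K i R).natDegree := by
  classical
  have hmono : ∀ (t : ι × (ι → ℕ) →₀ ℕ) (a : K), scaleHom K i (monomial t a) =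
      Polynomial.monomial (∑ v ∈ t.support with v.1 = i, t v) (monomial t a) := by
    intro t a
    rw [scaleHom, aeval_monomial, ← Polynomial.C_mul_X_pow_eq_monomial, monomial_eq, map_mul,
      Finsupp.prod, Finsupp.prod, map_prod, mul_assoc]
    congr 1
    rw [Finset.sum_filter, ← Finset.prod_pow_eq_pow_sum, ← Finset.prod_mul_distrib]
    refine Finset.prod_congr rfl fun v _ ↦ ?_
    split_ifs with hv
    · rw [mul_pow, map_pow]
    · rw [pow_zero, mul_one, map_pow]
  refine Polynomial.le_natDegree_of_ne_zero fun h ↦ mem_support_iff.mp hs ?_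
  rw [R.as_sum, map_sum] at h
  simp only [hmono, Polynomial.finsetSum_coeff, Polynomial.coeff_monomial] at h
  have h2 := congrArg (coeff s) h
  rw [coeff_sum, coeff_zero, Finset.sum_eq_single s] at h2
  · simpa [coeff_monomial] using h2
  · intro t _ hts
    split_ifs
    · rw [coeff_monomial, if_neg hts]
    · exact coeff_zero _
  · exact fun h ↦ absurd hs h

theorem totalDegree_coeff_prod_le {κ K σ : Type*} [Field K] (s : Finset σ)
    (P : σ → Polynomial (MvPolynomial κ K)) (e : σ → ℕ)
    (hP : ∀ v ∈ s, ∀ n, ((P v).coeff n).totalDegree ≤ e v) (n : ℕ) :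
    ((∏ v ∈ s, P v).coeff n).totalDegree ≤ ∑ v ∈ s, e v := by
  classical
  induction s using Finset.induction_on generalizing n with
  | empty =>
    rw [Finset.prod_empty, Polynomial.coeff_one]
    split_ifs <;> simp
  | insert a s ha ih =>
    rw [Finset.prod_insert ha, Finset.sum_insert ha, Polynomial.coeff_mul]
    refine totalDegree_finsetSum_le fun x _ ↦ (totalDegree_mul _ _).trans (add_le_add ?_ ?_)
    · exact hP a (Finset.mem_insert_self a s) _
    · exact ih (fun v hv ↦ hP v (Finset.mem_insert_of_mem hv)) _

theorem totalDegree_coeff_aeval_le {ι κ K : Type*} [Fintype ι] [DecidableEq ι] [Field K]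
    {R : MvPolynomial (ι × (ι → ℕ)) K} {D e : ι → ℕ}
    (hR : ∀ i, (scaleHom K i R).natDegree ≤ D i)
    {c : ι × (ι → ℕ) → Polynomial (MvPolynomial κ K)}
    (hc : ∀ v n, ((c v).coeff n).totalDegree ≤ e v.1) (n : ℕ) :
    ((aeval c R).coeff n).totalDegree ≤ ∑ i, e i * D i := by
  rw [aeval_def, eval₂_eq, Polynomial.finsetSum_coeff]
  refine totalDegree_finsetSum_le fun s hs ↦ ?_
  rw [IsScalarTower.algebraMap_apply K (MvPolynomial κ K), Polynomial.algebraMap_eq,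
    Polynomial.coeff_C_mul]
  refine (totalDegree_mul _ _).trans ?_
  rw [algebraMap_eq, totalDegree_C, zero_add]
  have hpow : ∀ v ∈ s.support, ∀ n, ((c v ^ s v).coeff n).totalDegree ≤ s v * e v.1 := by
    intro v _ n
    have := totalDegree_coeff_prod_le (Finset.range (s v)) (fun _ ↦ c v) (fun _ ↦ e v.1)
      (fun _ _ ↦ hc v) n
    simpa using this
  refine (totalDegree_coeff_prod_le _ _ _ hpow n).trans ?_
  rw [← Finset.sum_fiberwise s.support Prod.fst]
  refine Finset.sum_le_sum fun i _ ↦ ?_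
  calc ∑ v ∈ s.support with v.1 = i, s v * e v.1
      = e i * ∑ v ∈ s.support with v.1 = i, s v := by
        rw [Finset.mul_sum]
        refine Finset.sum_congr rfl fun v hv ↦ ?_
        rw [(Finset.mem_filter.mp hv).2, mul_comm]
    _ ≤ e i * D i :=
        Nat.mul_le_mul_left _ ((sum_filter_le_natDegree_scaleHom i hs).trans (hR i))

/-- The exponent of a monomial in the `x`-variables, homogenized in degree `n`. -/
def homExponent {m k : ℕ} (n : ℕ) (s : Fin m ⊕ Fin k →₀ ℕ) : Fin (m + 1) → ℕ :=
  Fin.cons (n - ∑ j, s (Sum.inl j)) fun j ↦ s (Sum.inl j)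

/-- The coefficient, a polynomial in the `y`-variables, of a monomial in the homogenized
`x`-variables. -/
noncomputable def xCoeff {K : Type*} [Field K] {m k : ℕ} (n : ℕ)
    (p : MvPolynomial (Fin m ⊕ Fin k) K) (α : Fin (m + 1) → ℕ) : MvPolynomial (Fin k) K :=
  ∑ s ∈ p.support with homExponent n s = α, C (p.coeff s) * ∏ j, X j ^ s (Sum.inr j)

variable {K : Type*} [Field K] {m k : ℕ}

theorem totalDegree_xCoeff_le (n : ℕ) (p : MvPolynomial (Fin m ⊕ Fin k) K)
    (α : Fin (m + 1) → ℕ) : (xCoeff n p α).totalDegree ≤ degInY p := by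
  refine totalDegree_finsetSum_le fun s hs ↦ (totalDegree_mul _ _).trans ?_
  rw [totalDegree_C, zero_add]
  refine (totalDegree_finsetProd _ _).trans ?_
  simp only [totalDegree_X_pow]
  exact Finset.le_sup (f := fun s : Fin m ⊕ Fin k →₀ ℕ ↦ ∑ j, s (Sum.inr j))
    (Finset.mem_filter.mp hs).1

theorem formEval_xCoeff (p : Fin (m + 1) → MvPolynomial (Fin m ⊕ Fin k) K) (i : Fin (m + 1)) :
    formEval (fun i ↦ degInX (p i))
      (fun v ↦ rename Sum.inr (xCoeff (degInX (p v.1)) (p v.1) v.2))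
      (Fin.cons 1 fun j ↦ X (Sum.inl j)) i = p i := by
  have hmaps : ∀ s ∈ (p i).support,
      homExponent (degInX (p i)) s ∈ Finset.piAntidiag Finset.univ (degInX (p i)) := by
    intro s hs
    have : ∑ j, s (Sum.inl j) ≤ degInX (p i) :=
      Finset.le_sup (f := fun s : Fin m ⊕ Fin k →₀ ℕ ↦ ∑ j, s (Sum.inl j)) hs
    simp only [Finset.mem_piAntidiag, homExponent, Fin.sum_univ_succ, Fin.cons_zero,
      Fin.cons_succ, Finset.mem_univ, implies_true, and_true]
    omega
  conv_rhs => rw [(p i).as_sum, ← Finset.sum_fiberwise_of_maps_to hmaps]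
  refine Finset.sum_congr rfl fun α _ ↦ ?_
  simp only [xCoeff]
  rw [map_sum, Finset.sum_mul]
  refine Finset.sum_congr rfl fun s hs ↦ ?_
  rw [← (Finset.mem_filter.mp hs).2, monomial_eq, Finsupp.prod_fintype _ _ (by simp),
    Fintype.prod_sum_type, Fin.prod_univ_succ]
  simp only [homExponent, Fin.cons_zero, Fin.cons_succ, one_pow, one_mul, map_mul, map_prod,
    map_pow, rename_C, rename_X]
  ring

theorem exists_eliminant (p : Fin (m + 1) → MvPolynomial (Fin m ⊕ Fin k) K)
    (hd : ∀ i, 1 ≤ degInX (p i)) :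
    ∃ (h : Polynomial (MvPolynomial (Fin k) K)) (q : Fin (m + 1) → MvPolynomial (Fin m ⊕ Fin k) K),
      h ≠ 0 ∧
      (∀ n, (h.coeff n).totalDegree ≤
        ∑ i, degInY (p i) * ∏ j ∈ Finset.univ.erase i, degInX (p j)) ∧
      ∀ Q : Ideal (Polynomial (MvPolynomial (Fin m ⊕ Fin k) K)),
        (∀ i, Polynomial.C (p i) + Polynomial.X * Polynomial.C (q i - p i) ∈ Q) →
        Polynomial.mapAlgHom (rename (R := K) Sum.inr) h ∈ Q := by
  obtain ⟨R, hR0, hRdeg, hRne⟩ := exists_resultant (K := K) hd 0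
  let δ : Fin (m + 1) × (Fin (m + 1) → ℕ) → K := fun v ↦
    if v.2 = Pi.single v.1 (degInX (p v.1)) then 1 else 0
  let a : Fin (m + 1) × (Fin (m + 1) → ℕ) → MvPolynomial (Fin k) K := fun v ↦
    xCoeff (degInX (p v.1)) (p v.1) v.2
  let c : Fin (m + 1) × (Fin (m + 1) → ℕ) → Polynomial (MvPolynomial (Fin k) K) := fun v ↦
    Polynomial.C (a v) + Polynomial.X * Polynomial.C (C (δ v) - a v)
  let x : Fin (m + 1) → MvPolynomial (Fin m ⊕ Fin k) K := Fin.cons 1 fun j ↦ X (Sum.inl j)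
  refine ⟨aeval c R, fun i ↦ formEval (fun i ↦ degInX (p i)) (fun v ↦ C (δ v)) x i, ?_, ?_, ?_⟩
  · intro h
    have h1 := comp_aeval_apply c
      ((Polynomial.aeval (1 : MvPolynomial (Fin k) K)).restrictScalars K) R
    rw [h, map_zero] at h1
    have h2 : (fun v ↦ (Polynomial.aeval (1 : MvPolynomial (Fin k) K)).restrictScalars K (c v)) =
        fun v ↦ Algebra.ofId K (MvPolynomial (Fin k) K) (δ v) := by
      funext v
      simp [c, Algebra.ofId_apply, algebraMap_eq]
    rw [h2, ← comp_aeval_apply, Algebra.ofId_apply, algebraMap_eq] at h1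
    exact hRne (C_eq_zero.mp h1.symm)
  · refine totalDegree_coeff_aeval_le hRdeg fun v n ↦ ?_
    have ha := totalDegree_xCoeff_le (degInX (p v.1)) (p v.1) v.2
    match n with
    | 0 => simpa [c] using ha
    | 1 =>
      have : (c v).coeff 1 = C (δ v) - a v := by simp [c, Polynomial.coeff_C]
      rw [this]
      refine (totalDegree_sub _ _).trans (max_le ?_ ha)
      simp
    | n + 2 =>
      have : (c v).coeff (n + 2) = 0 := by simp [c, Polynomial.coeff_X_mul]
      simp [this]
  · intro Q hQ
    rw [comp_aeval_apply]
    refine aeval_mem_of_genericZero Q hR0 _ (fun j ↦ Polynomial.C (x j)) (by simp [x]) fun i ↦ ?_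
    convert hQ i using 1
    have hp := formEval_xCoeff p i
    conv_rhs => rw [← hp]
    simp only [formEval, ← Finset.sum_sub_distrib, map_sum, Finset.mul_sum,
      ← Finset.sum_add_distrib]
    refine Finset.sum_congr rfl fun α _ ↦ ?_
    simp [x, c, a]
    ring

end Specialization

theorem MvPolynomial.exists_ne_zero_rename_mem_radical {K : Type*} [Field K] [IsAlgClosed K]
    {m k : ℕ} (hk : 1 ≤ k) (p : Fin (m + 1) → MvPolynomial (Fin m ⊕ Fin k) K)
    (hd : ∀ i, 1 ≤ degInX (p i))
    (hdim : ringKrullDim (MvPolynomial (Fin m ⊕ Fin k) K ⧸ Ideal.span (Set.range p)) ≤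
      ((k - 1 : ℕ) : WithBot ℕ∞)) :
    ∃ f : MvPolynomial (Fin k) K, f ≠ 0 ∧
      f.totalDegree ≤ ∑ i, degInY (p i) * ∏ j ∈ Finset.univ.erase i, degInX (p j) ∧
      rename Sum.inr f ∈ (Ideal.span (Set.range p)).radical := by
  obtain ⟨h, q, h0, hdeg, hmem⟩ := exists_eliminant p hd
  obtain ⟨h₁, hh₁, hX⟩ := Polynomial.exists_eq_pow_rootMultiplicity_mul_and_not_dvd h h0 0
  set e := h.rootMultiplicity 0
  rw [map_zero, sub_zero] at hh₁ hX
  refine ⟨h₁.coeff 0, fun hc ↦ hX (Polynomial.X_dvd_iff.mpr hc), ?_, ?_⟩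
  · have := hdeg e
    rwa [hh₁, Polynomial.coeff_X_pow_mul', if_pos le_rfl, Nat.sub_self] at this
  · rw [Ideal.radical_eq_jacobson, Ideal.jacobson, Ideal.mem_sInf]
    rintro M ⟨hIM, hM⟩
    let f : Fin (m + 1) → Polynomial (MvPolynomial (Fin m ⊕ Fin k) K) := fun i ↦
      Polynomial.C (p i) + Polynomial.X * Polynomial.C (q i - p i)
    have hf : ∀ i, (f i).coeff 0 = p i := fun i ↦ by simp [f]
    have hspan : Ideal.span (Set.range fun i ↦ (f i).coeff 0) = Ideal.span (Set.range p) := by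
      simp only [hf]
    obtain ⟨Q, hQ, hfQ, hXQ, hQM⟩ := Polynomial.exists_isPrime_X_notMem (d := k - 1) f M
      (fun i ↦ by rw [hf]; exact hIM (Ideal.subset_span ⟨i, rfl⟩))
      (by
        rw [MvPolynomial.height_eq_card_of_isMaximal M]
        simp only [Nat.card_eq_fintype_card, Fintype.card_sum, Fintype.card_fin]
        norm_cast
        omega)
      (by rw [hspan]; exact hdim)
    have hhQ := hmem Q hfQ
    rw [hh₁, map_mul, map_pow] at hhQ
    have hmapX : Polynomial.mapAlgHom (rename (R := K) (Sum.inr : Fin k → Fin m ⊕ Fin k))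
        Polynomial.X = Polynomial.X := Polynomial.map_X _
    rw [hmapX] at hhQ
    have h2 := hQM ((hQ.mem_or_mem hhQ).resolve_left fun h3 ↦ hXQ (hQ.mem_of_pow_mem _ h3))
    rw [Ideal.mem_comap, Polynomial.constantCoeff_apply] at h2
    simpa using h2

theorem MvPolynomial.totalDegree_le_of_dvd {σ R : Type*} [CommRing R] [IsDomain R]
    {f g : MvPolynomial σ R} (hfg : f ∣ g) (hg : g ≠ 0) : f.totalDegree ≤ g.totalDegree := by
  obtain ⟨q, rfl⟩ := hfg
  rw [totalDegree_mul_of_isDomain (left_ne_zero_of_mul hg) (right_ne_zero_of_mul hg)]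
  exact Nat.le_add_right _ _

theorem stmt11 {K : Type*} [Field K] [IsAlgClosed K] {m k : ℕ} (hm : 1 ≤ m) (hk : 1 ≤ k)
    (p : Fin (m + 1) → MvPolynomial (Fin m ⊕ Fin k) K)
    (dx dy : Fin (m + 1) → ℕ)
    (hdx : ∀ i, dx i = degInX (p i)) (hdy : ∀ i, dy i = degInY (p i))
    (hdx1 : ∀ i, 1 ≤ dx i)
    (I : Ideal (MvPolynomial (Fin m ⊕ Fin k) K)) (hI : I = Ideal.span (Set.range p))
    (hdim : ringKrullDim (MvPolynomial (Fin m ⊕ Fin k) K ⧸ I) = ((k - 1 : ℕ) : WithBot ℕ∞))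
    (g : MvPolynomial (Fin k) K) (hsf : Squarefree g)
    (helim : Ideal.comap
        (rename (Sum.inr : Fin k → Fin m ⊕ Fin k) :
          MvPolynomial (Fin k) K →ₐ[K] MvPolynomial (Fin m ⊕ Fin k) K) I =
      Ideal.span {g}) :
    g.totalDegree ≤ ∑ i : Fin (m + 1), dy i * ∏ j ∈ Finset.univ.erase i, dx j := by
  obtain rfl : dx = fun i ↦ degInX (p i) := funext hdx
  obtain rfl : dy = fun i ↦ degInY (p i) := funext hdy
  subst hI
  obtain ⟨f, hf0, hdeg, n, hn⟩ := exists_ne_zero_rename_mem_radical hk p hdx1 hdim.le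
  have hgf : g ∣ f ^ n := by
    rw [← Ideal.mem_span_singleton, ← helim, Ideal.mem_comap, map_pow]
    exact hn
  exact (totalDegree_le_of_dvd (hsf.isRadical n f hgf) hf0).trans hdeg
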